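/- Let w ∈ {0,1}^n and suppose that for every binary word u of length 3, the number of subsequences of w equal to u is d^{‖u‖₁}(1−d)^{3−‖u‖₁}·C(n,3) ± ε n³, where ‖u‖₁ is the number of ones in u. Then, for n sufficiently large (depending on ε), w is (d, 42ε^{1/3})-uniform: for every interval I ⊆ [n], the number of indices i ∈ I with w_i = 1 equals d|I| ± 42ε^{1/3} n. -/

import Mathlib

/-- The number of (ordered) index triples `i₁ < i₂ < i₃` in `w` realizing the
length-3 pattern `u`. -/
def subCount3 {n : ℕ} (w : Fin n → Bool) (u : Fin 3 → Bool) : ℕ :=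
  (Finset.univ.filter (fun p : Fin n × Fin n × Fin n =>
    p.1 < p.2.1 ∧ p.2.1 < p.2.2 ∧ w p.1 = u 0 ∧ w p.2.1 = u 1 ∧ w p.2.2 = u 2)).card

/-- The number of ones at a Boolean letter. -/
def bitVal (b : Bool) : ℝ := if b then 1 else 0

lemma two_mul_sum_mul_prefix_sum (x : ℕ → ℝ) (k : ℕ) :
    2 * ∑ j ∈ Finset.range k, ∑ i ∈ Finset.range j, x i * x j =
      (∑ i ∈ Finset.range k, x i) ^ 2 - ∑ i ∈ Finset.range k, x i ^ 2 := by
  induction k with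
  | zero => simp
  | succ k ih =>
    rw [Finset.sum_range_succ, Finset.sum_range_succ, Finset.sum_range_succ, mul_add, ih,
      ← Finset.sum_mul]
    ring

/-- A sequence with steps of size at most one starting from `0` has a square sum of at least
a third of the cube of its last entry. -/
lemma abs_cube_le_three_mul_sum_sq (F : ℕ → ℝ) (h0 : F 0 = 0)
    (hF : ∀ k, |F (k + 1) - F k| ≤ 1) (k : ℕ) :
    |F k| ^ 3 ≤ 3 * ∑ j ∈ Finset.range (k + 1), F j ^ 2 := by
  induction k with
  | zero => simp [h0]
  | succ k ih =>
    rw [Finset.sum_range_succ, mul_add, ← sq_abs (F (k + 1))]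
    have h1 : |F (k + 1)| ≤ |F k| + 1 := by
      have := abs_sub_abs_le_abs_sub (F (k + 1)) (F k)
      linarith [hF k]
    have h2 := abs_nonneg (F (k + 1))
    have h3 := abs_nonneg (F k)
    generalize |F (k + 1)| = b at *
    generalize |F k| = a at *
    suffices b ^ 3 ≤ a ^ 3 + 3 * b ^ 2 by linarith
    rcases le_total b 1 with hb | hb
    · have : b ^ 3 ≤ b ^ 2 := pow_le_pow_of_le_one h2 hb (by norm_num)
      have := pow_nonneg h3 3
      nlinarith [sq_nonneg b]
    · have : (b - 1) ^ 3 ≤ a ^ 3 := pow_le_pow_left₀ (by linarith) (by linarith) 3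
      nlinarith

/-- The sum over increasing triples of a product depending on the first two letters, expressed
through the subsequence counts. -/
lemma sum_triples_eq_sum_subCount3 {n : ℕ} (w : Fin n → Bool) (g : Bool → ℝ) :
    ∑ k : Fin n, ∑ j : Fin n, ∑ i : Fin n,
        (if i < j ∧ j < k then g (w i) * g (w j) else 0) =
      ∑ a : Bool, ∑ b : Bool, ∑ c : Bool, g a * g b * (subCount3 w ![a, b, c] : ℝ) := by
  have key : ∀ a b c : Bool, g a * g b * (subCount3 w ![a, b, c] : ℝ) =
      ∑ k : Fin n, ∑ j : Fin n, ∑ i : Fin n,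
        (if i < j ∧ j < k ∧ w i = a ∧ w j = b ∧ w k = c then g a * g b else 0) := by
    intro a b c
    rw [subCount3, Finset.card_filter, Nat.cast_sum, Finset.mul_sum, Fintype.sum_prod_type_right,
      Fintype.sum_prod_type_right]
    refine Finset.sum_congr rfl fun k _ => Finset.sum_congr rfl fun j _ =>
      Finset.sum_congr rfl fun i _ => ?_
    by_cases h : i < j ∧ j < k ∧ w i = a ∧ w j = b ∧ w k = c
    · simp [h]
    · rw [if_neg h, if_neg (by simpa using h), Nat.cast_zero, mul_zero]
  simp only [key, Fintype.sum_bool, ← Finset.sum_add_distrib]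
  refine Finset.sum_congr rfl fun k _ => Finset.sum_congr rfl fun j _ =>
    Finset.sum_congr rfl fun i _ => ?_
  by_cases hij : i < j <;> by_cases hjk : j < k <;> cases w i <;> cases w j <;> cases w k <;>
    simp [hij, hjk]

lemma sum_triples_fin_eq_sum_range {n : ℕ} (x : ℕ → ℝ) :
    ∑ k : Fin n, ∑ j : Fin n, ∑ i : Fin n,
        (if i < j ∧ j < k then x i * x j else 0) =
      ∑ k ∈ Finset.range n, ∑ j ∈ Finset.range k, ∑ i ∈ Finset.range j, x i * x j := by
  have restrict : ∀ (m : ℕ) (f : ℕ → ℝ), m ≤ n →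
      ∑ i : Fin n, (if (i : ℕ) < m then f i else 0) = ∑ i ∈ Finset.range m, f i := by
    intro m f hm
    rw [Fin.sum_univ_eq_sum_range (fun i => if i < m then f i else 0), ← Finset.sum_filter]
    congr 1
    ext i
    simp only [Finset.mem_filter, Finset.mem_range]
    omega
  rw [← Fin.sum_univ_eq_sum_range
    (fun k => ∑ j ∈ Finset.range k, ∑ i ∈ Finset.range j, x i * x j)]
  refine Finset.sum_congr rfl fun k _ => ?_
  rw [← restrict k _ k.2.le]
  refine Finset.sum_congr rfl fun j _ => ?_
  rw [← restrict j _ j.2.le]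
  by_cases hjk : j < k
  · simp [hjk]
  · simp [hjk]

/-- The weights `(a - d) (b - d)` annihilate the main terms of the subsequence counts. -/
lemma abs_sum_subCount3_le {n : ℕ} (w : Fin n → Bool) {d E : ℝ} (hd : d ∈ Set.Icc (0 : ℝ) 1)
    (hw : ∀ u : Fin 3 → Bool,
      |(subCount3 w u : ℝ) -
          d ^ ((Finset.univ.filter (fun i => u i = true)).card) *
            (1 - d) ^ (3 - (Finset.univ.filter (fun i => u i = true)).card) *
            (n.choose 3 : ℝ)| ≤ E) :
    |∑ a : Bool, ∑ b : Bool, ∑ c : Bool,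
        (bitVal a - d) * (bitVal b - d) * (subCount3 w ![a, b, c] : ℝ)| ≤ 2 * E := by
  obtain ⟨hd0, hd1⟩ := hd
  have hw' : ∀ a b c : Bool, |(subCount3 w ![a, b, c] : ℝ) -
      (if a then d else 1 - d) * (if b then d else 1 - d) * (if c then d else 1 - d) *
        (n.choose 3 : ℝ)| ≤ E := by
    intro a b c
    have h := hw ![a, b, c]
    rw [Finset.card_filter, Fin.sum_univ_three] at h
    convert h using 4
    cases a <;> cases b <;> cases c <;> simp [-mul_eq_mul_right_iff] <;> ring
  have scale : ∀ a b c : Bool, |(bitVal a - d) * (bitVal b - d) * ((subCount3 w ![a, b, c] : ℝ) -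
      (if a then d else 1 - d) * (if b then d else 1 - d) * (if c then d else 1 - d) *
        (n.choose 3 : ℝ))| ≤ (if a then 1 - d else d) * (if b then 1 - d else d) * E := by
    intro a b c
    have habs : ∀ a : Bool, |bitVal a - d| = if a then 1 - d else d := by
      intro a
      cases a
      · simp [bitVal, abs_of_nonneg hd0]
      · simp [bitVal, abs_of_nonneg (sub_nonneg.2 hd1)]
    rw [abs_mul, abs_mul, habs, habs]
    refine mul_le_mul_of_nonneg_left (hw' a b c) (mul_nonneg ?_ ?_) <;> split_ifs <;> linarith
  calc
    _ = |∑ a : Bool, ∑ b : Bool, ∑ c : Bool,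
          (bitVal a - d) * (bitVal b - d) * ((subCount3 w ![a, b, c] : ℝ) -
            (if a then d else 1 - d) * (if b then d else 1 - d) * (if c then d else 1 - d) *
              (n.choose 3 : ℝ))| := by
      congr 1
      simp [bitVal]
      ring
    _ ≤ ∑ a : Bool, ∑ b : Bool, ∑ c : Bool,
          (if a then 1 - d else d) * (if b then 1 - d else d) * E := by
      refine (Finset.abs_sum_le_sum_abs _ _).trans (Finset.sum_le_sum fun a _ => ?_)
      refine (Finset.abs_sum_le_sum_abs _ _).trans (Finset.sum_le_sum fun b _ => ?_)
      exact (Finset.abs_sum_le_sum_abs _ _).trans (Finset.sum_le_sum fun c _ => scale a b c)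
    _ = 2 * E := by
      simp
      ring

/-- The centred letters of `w`, extended by zero. -/
noncomputable def centredLetter {n : ℕ} (w : Fin n → Bool) (d : ℝ) (i : ℕ) : ℝ :=
  if h : i < n then bitVal (w ⟨i, h⟩) - d else 0

lemma abs_centredLetter_le_one {n : ℕ} (w : Fin n → Bool) {d : ℝ} (hd : d ∈ Set.Icc (0 : ℝ) 1)
    (i : ℕ) : |centredLetter w d i| ≤ 1 := by
  obtain ⟨hd0, hd1⟩ := hd
  unfold centredLetter bitVal
  rw [abs_le]
  split_ifs <;> constructor <;> linarith

lemma abs_sum_range_centredLetter_le {n : ℕ} (w : Fin n → Bool) {d : ℝ}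
    (hd : d ∈ Set.Icc (0 : ℝ) 1) (k : ℕ) :
    |∑ i ∈ Finset.range k, centredLetter w d i| ≤ k := by
  refine (Finset.abs_sum_le_sum_abs _ _).trans ?_
  refine (Finset.sum_le_sum fun i _ => abs_centredLetter_le_one w hd i).trans ?_
  simp

lemma card_ones_sub_eq_sum_Ico {n : ℕ} (w : Fin n → Bool) (d : ℝ) (a b : ℕ) :
    ((Finset.univ.filter (fun i : Fin n => a ≤ i.val ∧ i.val < b ∧ w i = true)).card : ℝ) -
        d * ((Finset.univ.filter (fun i : Fin n => a ≤ i.val ∧ i.val < b)).card : ℝ) =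
      ∑ i ∈ Finset.Ico a (min b n), centredLetter w d i := by
  have h : ∑ i ∈ Finset.Ico a (min b n), centredLetter w d i =
      ∑ i : Fin n, if a ≤ i.val ∧ i.val < b then centredLetter w d i else 0 := by
    rw [Fin.sum_univ_eq_sum_range (fun i => if a ≤ i ∧ i < b then centredLetter w d i else 0),
      ← Finset.sum_filter]
    congr 1
    ext i
    simp only [Finset.mem_filter, Finset.mem_range, Finset.mem_Ico]
    omega
  rw [h, Finset.card_filter, Finset.card_filter, Nat.cast_sum, Nat.cast_sum, Finset.mul_sum,
    ← Finset.sum_sub_distrib]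
  refine Finset.sum_congr rfl fun i _ => ?_
  by_cases h1 : a ≤ i.val <;> by_cases h2 : i.val < b <;> cases hi : w i <;>
    simp [h1, h2, hi, centredLetter, bitVal]

lemma sum_sq_prefix_sum_le {n : ℕ} (w : Fin n → Bool) {d E : ℝ} (hd : d ∈ Set.Icc (0 : ℝ) 1)
    (hw : ∀ u : Fin 3 → Bool,
      |(subCount3 w u : ℝ) -
          d ^ ((Finset.univ.filter (fun i => u i = true)).card) *
            (1 - d) ^ (3 - (Finset.univ.filter (fun i => u i = true)).card) *
            (n.choose 3 : ℝ)| ≤ E) :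
    ∑ k ∈ Finset.range (n + 1), (∑ i ∈ Finset.range k, centredLetter w d i) ^ 2 ≤
      4 * E + 2 * (n : ℝ) ^ 2 := by
  have htriple : ∑ k ∈ Finset.range n, ∑ j ∈ Finset.range k, ∑ i ∈ Finset.range j,
      centredLetter w d i * centredLetter w d j ≤ 2 * E := by
    refine le_trans (le_of_eq ?_) ((le_abs_self _).trans (abs_sum_subCount3_le w hd hw))
    rw [← sum_triples_fin_eq_sum_range,
      ← sum_triples_eq_sum_subCount3 w (fun a => bitVal a - d)]
    simp [centredLetter]
  have hdiag : ∑ k ∈ Finset.range n, ∑ i ∈ Finset.range k, centredLetter w d i ^ 2 ≤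
      (n : ℝ) ^ 2 := by
    calc
      _ ≤ ∑ k ∈ Finset.range n, (n : ℝ) := by
        refine Finset.sum_le_sum fun k hk => ?_
        have hkn : (k : ℝ) ≤ n := by exact_mod_cast (Finset.mem_range.1 hk).le
        refine (Finset.sum_le_sum fun i _ =>
          (sq_le_one_iff_abs_le_one _).2 (abs_centredLetter_le_one w hd i)).trans ?_
        simpa using hkn
      _ = (n : ℝ) ^ 2 := by simp [sq]
  have hsq : ∑ k ∈ Finset.range n, (∑ i ∈ Finset.range k, centredLetter w d i) ^ 2 =
      2 * (∑ k ∈ Finset.range n, ∑ j ∈ Finset.range k, ∑ i ∈ Finset.range j,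
        centredLetter w d i * centredLetter w d j) +
      ∑ k ∈ Finset.range n, ∑ i ∈ Finset.range k, centredLetter w d i ^ 2 := by
    rw [Finset.mul_sum, ← Finset.sum_add_distrib]
    refine Finset.sum_congr rfl fun k _ => ?_
    rw [two_mul_sum_mul_prefix_sum]
    ring
  have hlast : (∑ i ∈ Finset.range n, centredLetter w d i) ^ 2 ≤ (n : ℝ) ^ 2 :=
    sq_le_sq' (abs_le.1 (abs_sum_range_centredLetter_le w hd n)).1
      (abs_le.1 (abs_sum_range_centredLetter_le w hd n)).2
  rw [Finset.sum_range_succ, hsq]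
  linarith

/-- Counting length-3 subsequences forces uniformity. -/
theorem stmt19 (ε : ℝ) (hε : 0 < ε) (d : ℝ) (hd : d ∈ Set.Icc (0:ℝ) 1) :
    ∃ n₀ : ℕ, ∀ n > n₀, ∀ w : Fin n → Bool,
      (∀ u : Fin 3 → Bool,
        |(subCount3 w u : ℝ) -
            d ^ ((Finset.univ.filter (fun i => u i = true)).card) *
              (1 - d) ^ (3 - (Finset.univ.filter (fun i => u i = true)).card) *
              (n.choose 3 : ℝ)|
          ≤ ε * (n : ℝ) ^ 3) →
      ∀ a b : ℕ,
        |(((Finset.univ.filter (fun i : Fin n => a ≤ i.val ∧ i.val < b ∧ w i = true)).card : ℝ)) -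
            d * ((Finset.univ.filter (fun i : Fin n => a ≤ i.val ∧ i.val < b)).card : ℝ)|
          ≤ 42 * ε ^ ((1:ℝ)/3) * (n : ℝ) := by
  obtain ⟨n₀, hn₀⟩ := exists_nat_gt (1 / ε)
  refine ⟨n₀, fun n hn w hw a b => ?_⟩
  have hεn : 1 ≤ ε * n := by
    have : (n₀ : ℝ) < n := by exact_mod_cast hn
    have := (div_lt_iff₀' hε).1 (hn₀.trans this)
    exact this.le
  have hroot : (ε ^ ((1 : ℝ) / 3)) ^ 3 = ε := by
    rw [← Real.rpow_natCast, ← Real.rpow_mul hε.le]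
    norm_num
  have hr : 0 ≤ ε ^ ((1 : ℝ) / 3) := Real.rpow_nonneg hε.le _
  have hprefix : ∀ k ≤ n, |∑ i ∈ Finset.range k, centredLetter w d i| ≤
      21 * ε ^ ((1 : ℝ) / 3) * n := by
    intro k hk
    refine le_of_pow_le_pow_left₀ (n := 3) (by norm_num) (by positivity) ?_
    have hcube := abs_cube_le_three_mul_sum_sq
      (fun k => ∑ i ∈ Finset.range k, centredLetter w d i) (by simp)
      (fun k => by
        simpa [Finset.sum_range_succ] using abs_centredLetter_le_one w hd k) k
    have hmono : ∑ j ∈ Finset.range (k + 1), (∑ i ∈ Finset.range j, centredLetter w d i) ^ 2 ≤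
        ∑ j ∈ Finset.range (n + 1), (∑ i ∈ Finset.range j, centredLetter w d i) ^ 2 :=
      Finset.sum_le_sum_of_subset_of_nonneg (Finset.range_subset_range.2 (by omega))
        fun _ _ _ => sq_nonneg _
    have hsum := sum_sq_prefix_sum_le w hd hw
    have hsmall : (n : ℝ) ^ 2 ≤ ε * (n : ℝ) ^ 3 := by
      nlinarith [mul_le_mul_of_nonneg_right hεn (sq_nonneg (n : ℝ))]
    have hpos : 0 ≤ ε * (n : ℝ) ^ 3 := by positivity
    rw [mul_pow, mul_pow, hroot]
    linarith
  rw [card_ones_sub_eq_sum_Ico]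
  rcases le_total a (min b n) with hab | hab
  · rw [Finset.sum_Ico_eq_sub _ hab]
    have h1 := hprefix (min b n) (min_le_right _ _)
    have h2 := hprefix a (hab.trans (min_le_right _ _))
    refine (abs_sub _ _).trans ?_
    linarith
  · rw [Finset.Ico_eq_empty_of_le hab]
    simp only [Finset.sum_empty, abs_zero]
    positivity
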